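/- arXiv:math/0609026 — 4 statements merged into one kernel-verified Lean document; each statement's English description precedes it below -/
import Mathlib

section
/- There exists κ ∈ (0,1) such that for every b > 0 and every 2π-periodic C¹ function r : ℝ → ℝ satisfying |r(z)| ≤ κ b for all z ∈ ℝ and ∫₀^{2π} (2 b r(z) + r(z)²) dz = 0, one has ∫₀^{2π} r(z)² dz ≤ 2 ∫₀^{2π} r′(z)² dz. -/
open MeasureTheory in
/-- **Wirtinger's inequality**: a function with mean zero and equal values at the endpoints of an
interval is controlled in `L²` by its derivative, with the sharp constant. -/
theorem integral_norm_sq_le_of_integral_eq_zero {a b : ℝ} (hab : a < b) {f f' : ℝ → ℂ}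
    (hf : ∀ x, HasDerivAt f (f' x) x) (hf' : Continuous f') (hfab : f a = f b)
    (hmean : ∫ x in a..b, f x = 0) :
    ∫ x in a..b, ‖f x‖ ^ 2 ≤ ((b - a) / (2 * Real.pi)) ^ 2 * ∫ x in a..b, ‖f' x‖ ^ 2 := by
  have hba : 0 < b - a := sub_pos.2 hab
  have memLp {g : ℝ → ℂ} (hg : Continuous g) : MemLp g 2 (volume.restrict (Set.Ioc a b)) :=
    (memLp_two_iff_integrable_sq_norm hg.aestronglyMeasurable).2
      (hg.norm.pow 2).integrableOn_Ioc
  have hfc : Continuous f := continuous_iff_continuousAt.2 fun x => (hf x).continuousAt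
  have parseval := hasSum_sq_fourierCoeffOn hab (memLp hfc)
  have parseval' := (hasSum_sq_fourierCoeffOn hab (memLp hf')).mul_left
    (((b - a) / (2 * Real.pi)) ^ 2)
  have hle := hasSum_le (fun n => ?_) parseval parseval'
  · simp only [smul_eq_mul] at hle
    rw [mul_left_comm] at hle
    exact le_of_mul_le_mul_left hle (inv_pos.2 hba)
  · rcases eq_or_ne n 0 with rfl | hn
    · have h0 : fourierCoeffOn hab f 0 = 0 := by
        simp [fourierCoeffOn_eq_integral, hmean]
      rw [h0]
      simp only [norm_zero, ne_eq, OfNat.ofNat_ne_zero, not_false_eq_true, zero_pow]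
      exact mul_nonneg (sq_nonneg _) (sq_nonneg _)
    · rw [fourierCoeffOn_of_hasDerivAt hab hn (fun x _ => hf x) (hf'.intervalIntegrable _ _),
        hfab, ← mul_pow]
      have hn1 : (1 : ℝ) ≤ |(n : ℝ)| := by exact_mod_cast Int.one_le_abs hn
      have hnorm : ‖(b : ℂ) - a‖ = b - a := by
        rw [← Complex.ofReal_sub, Complex.norm_real, Real.norm_of_nonneg hba.le]
      gcongr
      simp only [sub_self, mul_zero, zero_sub, norm_mul, norm_neg, norm_div, norm_one, hnorm,
        Complex.norm_I, Complex.norm_real, Complex.norm_intCast, Complex.norm_ofNat,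
        Real.norm_of_nonneg Real.pi_pos.le, mul_one]
      rw [← mul_assoc, div_mul_eq_mul_div, one_mul]
      refine mul_le_mul_of_nonneg_right (div_le_div_of_nonneg_left hba.le Real.two_pi_pos ?_)
        (norm_nonneg _)
      exact le_mul_of_one_le_right (by positivity) hn1

/-- Wirtinger's inequality for real-valued functions. -/
theorem integral_sq_le_of_integral_eq_zero {a b : ℝ} (hab : a < b) {f f' : ℝ → ℝ}
    (hf : ∀ x, HasDerivAt f (f' x) x) (hf' : Continuous f') (hfab : f a = f b)
    (hmean : ∫ x in a..b, f x = 0) :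
    ∫ x in a..b, f x ^ 2 ≤ ((b - a) / (2 * Real.pi)) ^ 2 * ∫ x in a..b, f' x ^ 2 := by
  have h := integral_norm_sq_le_of_integral_eq_zero hab (f := fun x => (f x : ℂ))
    (f' := fun x => (f' x : ℂ)) (fun x => (hf x).ofReal_comp)
    (Complex.continuous_ofReal.comp hf') (by rw [hfab])
    (by rw [intervalIntegral.integral_ofReal, hmean, Complex.ofReal_zero])
  simpa only [Complex.norm_real, Real.norm_eq_abs, sq_abs] using h

/-- The Poincaré-type inequality for the constrained perturbation `r` of the
modulus of a plane wave `Q_{0,b} ≡ b` of the defocusing NLS equation. -/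
theorem constrained_poincare :
    ∃ κ : ℝ, 0 < κ ∧ κ < 1 ∧
    ∀ b : ℝ, 0 < b →
    ∀ r : ℝ → ℝ, Function.Periodic r (2*Real.pi) → ContDiff ℝ 1 r →
      (∀ z, |r z| ≤ κ * b) →
      (∫ z in (0:ℝ)..(2*Real.pi), (2*b*(r z) + (r z)^2)) = 0 →
      (∫ z in (0:ℝ)..(2*Real.pi), (r z)^2)
        ≤ 2 * ∫ z in (0:ℝ)..(2*Real.pi), (deriv r z)^2 := by
  refine ⟨1 / 10, by norm_num, by norm_num, fun b hb r hper hr hbound hN => ?_⟩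
  have hpi : 0 < 2 * Real.pi := by positivity
  have hc : Continuous r := hr.continuous
  have hc' : Continuous (deriv r) := hr.continuous_deriv le_rfl
  have hd (z : ℝ) : HasDerivAt (fun z => 2 * b * r z + r z ^ 2) (2 * (b + r z) * deriv r z) z := by
    have h := (hr.differentiable one_ne_zero z).hasDerivAt
    refine ((h.const_mul (2 * b)).add (h.pow 2)).congr_deriv ?_
    push_cast
    ring
  have hr0 : r 0 = r (2 * Real.pi) := by simpa using (hper 0).symm
  have wirtinger := integral_sq_le_of_integral_eq_zero hpi hd (by fun_prop) (by rw [hr0]) hN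
  rw [sub_zero, div_self hpi.ne', one_pow, one_mul] at wirtinger
  have lower : (19 / 10 * b) ^ 2 * ∫ z in (0:ℝ)..(2*Real.pi), r z ^ 2 ≤
      ∫ z in (0:ℝ)..(2*Real.pi), (2 * b * r z + r z ^ 2) ^ 2 := by
    rw [← intervalIntegral.integral_const_mul]
    refine intervalIntegral.integral_mono hpi.le (Continuous.intervalIntegrable (by fun_prop) _ _)
      (Continuous.intervalIntegrable (by fun_prop) _ _) fun z => ?_
    have hz := abs_le.1 (hbound z)
    have : (19 / 10 * b) ^ 2 ≤ (2 * b + r z) ^ 2 := by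
      gcongr
      linarith
    calc (19 / 10 * b) ^ 2 * r z ^ 2 ≤ (2 * b + r z) ^ 2 * r z ^ 2 := by gcongr
      _ = (2 * b * r z + r z ^ 2) ^ 2 := by ring
  have upper : ∫ z in (0:ℝ)..(2*Real.pi), (2 * (b + r z) * deriv r z) ^ 2 ≤
      (22 / 10 * b) ^ 2 * ∫ z in (0:ℝ)..(2*Real.pi), deriv r z ^ 2 := by
    rw [← intervalIntegral.integral_const_mul]
    refine intervalIntegral.integral_mono hpi.le (Continuous.intervalIntegrable (by fun_prop) _ _)
      (Continuous.intervalIntegrable (by fun_prop) _ _) fun z => ?_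
    have hz := abs_le.1 (hbound z)
    have : (2 * (b + r z)) ^ 2 ≤ (22 / 10 * b) ^ 2 := by
      rw [sq_le_sq₀ (by linarith) (by positivity)]
      linarith
    calc (2 * (b + r z) * deriv r z) ^ 2 = (2 * (b + r z)) ^ 2 * deriv r z ^ 2 := by ring
      _ ≤ (22 / 10 * b) ^ 2 * deriv r z ^ 2 := by gcongr
  have hnonneg : 0 ≤ ∫ z in (0:ℝ)..(2*Real.pi), deriv r z ^ 2 :=
    intervalIntegral.integral_nonneg hpi.le fun z _ => sq_nonneg _
  have key := lower.trans (wirtinger.trans upper)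
  rw [mul_pow, mul_pow, mul_right_comm, mul_right_comm _ (b ^ 2)] at key
  have := le_of_mul_le_mul_right key (by positivity)
  linarith
end

section
/- For every γ* ∈ (0, 1/4) there exist positive constants c* and δ* such that for all γ ∈ [γ*, 1/2 − γ*], all p, k ∈ ℝ with |p−1| ≤ δ* and |k−1| ≤ δ*, all n, m ∈ ℤ, and all signs σ, τ ∈ {+,−} with (σ,n) ≠ (τ,m), one has |ω^{σ,n}_{p,k,γ} − ω^{τ,m}_{p,k,γ}| ≥ c*. -/
/-- The purely imaginary eigenvalues `i ω^{±,n}_{p,k,γ}` of the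
constant-coefficient Bloch operators: `ω^{±,n} = -4pk(n+γ) ± (4k²(n+γ)² + p² - 1)`.
Here the sign `+` is encoded by `true` and `-` by `false`. -/
noncomputable def omegaE (p k γ : ℝ) (σ : Bool) (n : ℤ) : ℝ :=
  -4*p*k*((n:ℝ) + γ) + (if σ then 1 else -1) * (4*k^2*((n:ℝ) + γ)^2 + p^2 - 1)

/-- If `s` stays away from `1`, then `k * s - p` stays away from `0` for `p, k` close to `1`. -/
lemma le_abs_mul_sub_of_two_mul_le_abs {e d p k s : ℝ} (he : 0 < e) (he' : e < 1 / 4)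
    (hd : 0 < d) (hd' : d ≤ e / 100) (hp : |p - 1| ≤ d) (hk : |k - 1| ≤ d)
    (hs : 2 * e ≤ |s - 1|) : e ≤ |k * s - p| := by
  rw [abs_le] at hp hk
  rcases le_abs'.1 hs with h | h
  · refine le_abs'.2 (Or.inl ?_)
    nlinarith [mul_le_mul_of_nonneg_left h (by linarith : 0 ≤ k)]
  · refine le_abs'.2 (Or.inr ?_)
    nlinarith [mul_le_mul_of_nonneg_left h (by linarith : 0 ≤ k)]

/-- Two times a number in `[e, 1/2 - e]` is at distance at least `2 * e` from the integers. -/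
lemma two_mul_le_abs_intCast_add_two_mul {e g : ℝ} (hg : g ∈ Set.Icc e (1 / 2 - e)) (j : ℤ) :
    2 * e ≤ |(j : ℝ) + 2 * g| := by
  obtain ⟨h1, h2⟩ := hg
  rcases le_or_gt 0 j with h | h
  · have : (0 : ℝ) ≤ j := by exact_mod_cast h
    exact le_abs'.2 (Or.inr (by linarith))
  · have : (j : ℝ) ≤ -1 := by exact_mod_cast (by omega : j ≤ -1)
    exact le_abs'.2 (Or.inl (by linarith))

lemma sq_le_abs_four_mul_mul {e k u v : ℝ} (he : 0 < e) (he' : e < 1 / 4) (hk : 1 / 2 ≤ k)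
    (hu : 1 ≤ |u|) (hv : e ≤ |v|) : e ^ 2 ≤ |4 * k * u * v| := by
  rw [abs_mul, abs_mul, abs_of_nonneg (by linarith : 0 ≤ 4 * k)]
  have h1 : 1 ≤ 4 * k * |u| := by nlinarith
  nlinarith

/-- The difference of eigenvalues of opposite sign is `A ^ 2 + B ^ 2 - 2`; it does not get small. -/
lemma sq_le_abs_sq_add_sq_sub_two {e d p k g : ℝ} (he : 0 < e) (he' : e < 1 / 4)
    (hd : 0 < d) (hd' : d = e ^ 2 / 100) (hp : |p - 1| ≤ d) (hk : |k - 1| ≤ d)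
    (hg : g ∈ Set.Icc e (1 / 2 - e)) (n m : ℤ) :
    e ^ 2 ≤ |(2 * k * (n + g) - p) ^ 2 + (2 * k * (m + g) + p) ^ 2 - 2| := by
  obtain ⟨h1, h2⟩ := hg
  rw [abs_le] at hp hk
  obtain ⟨hp1, hp2⟩ := hp
  obtain ⟨hk1, hk2⟩ := hk
  have hd1 : d ≤ e / 400 := by nlinarith
  have he2 : e ^ 2 ≤ 1 / 16 := by nlinarith
  have hk0 : 0 ≤ k := by linarith
  have hkg1 : k * e ≤ k * g := mul_le_mul_of_nonneg_left h1 hk0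
  have hkg2 : k * g ≤ k * (1 / 2 - e) := mul_le_mul_of_nonneg_left h2 hk0
  have hke : 99 / 100 * e ≤ k * e := mul_le_mul_of_nonneg_right (by linarith) he.le
  have hA := sq_nonneg (2 * k * (n + g) - p)
  have hB := sq_nonneg (2 * k * (m + g) + p)
  have key : ∀ a : ℝ, 19 / 10 ≤ |a| → 3 ≤ a ^ 2 := fun a ha => by
    rw [← sq_abs]; nlinarith
  have hn : 2 ≤ n ∨ n ≤ -1 ∨ n = 0 ∨ n = 1 := by omega
  have hm : 1 ≤ m ∨ m ≤ -2 ∨ m = 0 ∨ m = -1 := by omega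
  rcases hn with h | h | hn
  · have h' : (2 : ℝ) ≤ n := by exact_mod_cast h
    have := key (2 * k * (n + g) - p) (le_abs'.2 (Or.inr (by nlinarith)))
    exact le_abs'.2 (Or.inr (by linarith))
  · have h' : (n : ℝ) ≤ -1 := by exact_mod_cast h
    have := key (2 * k * (n + g) - p) (le_abs'.2 (Or.inl (by nlinarith)))
    exact le_abs'.2 (Or.inr (by linarith))
  rcases hm with h | h | hm
  · have h' : (1 : ℝ) ≤ m := by exact_mod_cast h
    have := key (2 * k * (m + g) + p) (le_abs'.2 (Or.inr (by nlinarith)))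
    exact le_abs'.2 (Or.inr (by linarith))
  · have h' : (m : ℝ) ≤ -2 := by exact_mod_cast h
    have := key (2 * k * (m + g) + p) (le_abs'.2 (Or.inl (by nlinarith)))
    exact le_abs'.2 (Or.inr (by linarith))
  have hkg_sq : (99 / 100 * e) ^ 2 ≤ (k * g) ^ 2 :=
    pow_le_pow_left₀ (by linarith) (hke.trans hkg1) 2
  rcases hn with rfl | rfl <;> rcases hm with rfl | rfl <;> push_cast
  · refine le_abs'.2 (Or.inr ?_)
    nlinarith
  · refine le_abs'.2 (Or.inl ?_)
    have hA' : (2 * k * (0 + g) - p) ^ 2 ≤ (1 - e) ^ 2 :=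
      sq_le_sq' (by linarith) (by linarith)
    have hB' : (2 * k * (-1 + g) + p) ^ 2 ≤ (1 - e) ^ 2 :=
      sq_le_sq' (by linarith) (by linarith)
    nlinarith
  · refine le_abs'.2 (Or.inr ?_)
    have hA' : 1 ^ 2 ≤ (2 * k * (1 + g) - p) ^ 2 :=
      pow_le_pow_left₀ (by norm_num) (by linarith) 2
    have hB' : (1 + e) ^ 2 ≤ (2 * k * (0 + g) + p) ^ 2 :=
      pow_le_pow_left₀ (by linarith) (by linarith) 2
    nlinarith
  · refine le_abs'.2 (Or.inr ?_)
    have hkp : (1 - 3 * d) ^ 2 ≤ (2 * k - p) ^ 2 :=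
      pow_le_pow_left₀ (by linarith) (by linarith) 2
    have hsum : (2 * k * (1 + g) - p) ^ 2 + (2 * k * (-1 + g) + p) ^ 2 - 2 =
        8 * (k * g) ^ 2 + 2 * (2 * k - p) ^ 2 - 2 := by ring
    rw [hsum]
    linarith [sq_nonneg d, sq_nonneg e]

/-- Uniform separation of the eigenvalues of the constant-coefficient Bloch
operators when `γ` is bounded away from `0` and `1/2`. -/
theorem eigenvalue_separation_middle_gamma :
    ∀ γs : ℝ, 0 < γs → γs < 1/4 →
    ∃ cs > (0:ℝ), ∃ δs > (0:ℝ),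
    ∀ γ ∈ Set.Icc γs (1/2 - γs),
    ∀ p k : ℝ, |p - 1| ≤ δs → |k - 1| ≤ δs →
    ∀ (σ τ : Bool) (n m : ℤ), (σ, n) ≠ (τ, m) →
      |omegaE p k γ σ n - omegaE p k γ τ m| ≥ cs := by
  intro e he he'
  have hd : 0 < e ^ 2 / 100 := by positivity
  have hd' : e ^ 2 / 100 ≤ e / 100 := by nlinarith
  refine ⟨e ^ 2, by positivity, e ^ 2 / 100, hd, ?_⟩
  intro g hg p k hp hk σ τ n m hne
  have hk' : 1 / 2 ≤ k := by
    have := (abs_le.1 hk).1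
    linarith
  have hsub (h : n ≠ m) : 1 ≤ |(n : ℝ) - m| := by
    exact_mod_cast Int.one_le_abs (sub_ne_zero.2 h)
  rw [ge_iff_le]
  cases σ <;> cases τ
  · have hs : 2 * e ≤ |-((n : ℝ) + m + 2 * g) - 1| := by
      have := two_mul_le_abs_intCast_add_two_mul hg (n + m + 1)
      rw [← abs_neg] at this
      refine this.trans_eq (congrArg _ ?_)
      push_cast
      ring
    have := sq_le_abs_four_mul_mul he he' hk' (hsub (by simpa using hne))
      (le_abs_mul_sub_of_two_mul_le_abs he he' hd hd' hp hk hs)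
    refine this.trans_eq (congrArg _ ?_)
    simp only [omegaE, Bool.false_eq_true, if_false]
    ring
  · rw [abs_sub_comm]
    refine (sq_le_abs_sq_add_sq_sub_two he he' hd rfl hp hk hg m n).trans_eq (congrArg _ ?_)
    simp only [omegaE, Bool.false_eq_true, if_false, if_true]
    ring
  · refine (sq_le_abs_sq_add_sq_sub_two he he' hd rfl hp hk hg n m).trans_eq (congrArg _ ?_)
    simp only [omegaE, Bool.false_eq_true, if_false, if_true]
    ring
  · have hs : 2 * e ≤ |((n : ℝ) + m + 2 * g) - 1| := by
      refine (two_mul_le_abs_intCast_add_two_mul hg (n + m - 1)).trans_eq (congrArg _ ?_)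
      push_cast
      ring
    have := sq_le_abs_four_mul_mul he he' hk' (hsub (by simpa using hne))
      (le_abs_mul_sub_of_two_mul_le_abs he he' hd hd' hp hk hs)
    refine this.trans_eq (congrArg _ ?_)
    simp only [omegaE, if_true]
    ring
end

section
/- There exist positive constants γ₀, c, and δ such that for all γ ∈ [0, γ₀] and all p, k ∈ ℝ with |p−1| ≤ δ and |k−1| ≤ δ, the following hold, writing ω^{±,n} := ω^{±,n}_{p,k,γ}: (i) |ω^{+,0}| < 1, |ω^{−,0}| < 1, |ω^{+,1}| < 1, and |ω^{−,−1}| < 1; (ii) |ω^{−,1}| ≥ 4, |ω^{+,−1}| ≥ 4, and |ω^{+,n}| ≥ 4 and |ω^{−,n}| ≥ 4 for every n ∈ ℤ \ {−1,0,1}; (iii) |ω^{+,n} − ω^{+,m}| ≥ c for all n, m ∈ ℤ \ {0,1} with m ≠ n and m ≠ 1−n; (iv) |ω^{−,n} − ω^{−,m}| ≥ c for all n, m ∈ ℤ \ {−1,0} with m ≠ n and m ≠ −1−n; (v) |ω^{+,n} − ω^{−,m}| ≥ c for all n ∈ ℤ \ {0,1} and m ∈ ℤ \ {−1,0}. -/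
theorem omegaE_true (p k γ : ℝ) (n : ℤ) :
    omegaE p k γ true n = (2 * k * (n + γ) - p) ^ 2 - 1 := by
  simp only [omegaE, if_true]
  ring

theorem omegaE_false (p k γ : ℝ) (n : ℤ) :
    omegaE p k γ false n = 1 - (2 * k * (n + γ) + p) ^ 2 := by
  simp only [omegaE, Bool.false_eq_true, if_false]
  ring

theorem four_le_omegaE_true {p k γ : ℝ} (hγ : γ ∈ Set.Icc (0 : ℝ) (1 / 20))
    (hp : |p - 1| ≤ 1 / 20) (hk : |k - 1| ≤ 1 / 20) {n : ℤ} (h0 : n ≠ 0) (h1 : n ≠ 1) :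
    4 ≤ omegaE p k γ true n := by
  rw [omegaE_true]
  obtain ⟨hγ0, hγ1⟩ := hγ
  rw [abs_le] at hp hk
  rcases (by omega : n ≤ -1 ∨ 2 ≤ n) with h | h
  · have hn : (n : ℝ) ≤ -1 := by exact_mod_cast h
    have : 2 * k * (n + γ) - p ≤ -(9 / 4) := by
      nlinarith [mul_nonneg (by linarith : (0 : ℝ) ≤ k) (by linarith : 0 ≤ -19 / 20 - (n + γ))]
    nlinarith
  · have hn : (2 : ℝ) ≤ n := by exact_mod_cast h
    have : 9 / 4 ≤ 2 * k * (n + γ) - p := by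
      nlinarith [mul_nonneg (by linarith : (0 : ℝ) ≤ k) (by linarith : 0 ≤ n + γ - 2)]
    nlinarith

theorem omegaE_false_le_neg_four {p k γ : ℝ} (hγ : γ ∈ Set.Icc (0 : ℝ) (1 / 20))
    (hp : |p - 1| ≤ 1 / 20) (hk : |k - 1| ≤ 1 / 20) {n : ℤ} (h1 : n ≠ -1) (h0 : n ≠ 0) :
    omegaE p k γ false n ≤ -4 := by
  rw [omegaE_false]
  obtain ⟨hγ0, hγ1⟩ := hγ
  rw [abs_le] at hp hk
  rcases (by omega : n ≤ -2 ∨ 1 ≤ n) with h | h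
  · have hn : (n : ℝ) ≤ -2 := by exact_mod_cast h
    have : 2 * k * (n + γ) + p ≤ -(9 / 4) := by
      nlinarith [mul_nonneg (by linarith : (0 : ℝ) ≤ k) (by linarith : 0 ≤ -39 / 20 - (n + γ))]
    nlinarith
  · have hn : (1 : ℝ) ≤ n := by exact_mod_cast h
    have : 9 / 4 ≤ 2 * k * (n + γ) + p := by
      nlinarith [mul_nonneg (by linarith : (0 : ℝ) ≤ k) (by linarith : 0 ≤ n + γ - 1)]
    nlinarith

theorem one_le_abs_four_mul_mul {k r : ℝ} (hk : 19 / 20 ≤ k) (hr : |r| ≤ 1 / 4) {d N : ℤ}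
    (hd : d ≠ 0) (hN : N ≠ 0) : 1 ≤ |4 * k * d * (k * N + r)| := by
  have hd' : (1 : ℝ) ≤ |(d : ℝ)| := by exact_mod_cast Int.one_le_abs hd
  have hN' : (1 : ℝ) ≤ |(N : ℝ)| := by exact_mod_cast Int.one_le_abs hN
  have h1 : 3 ≤ |4 * k * d| := by
    rw [abs_mul, abs_of_pos (by linarith : 0 < 4 * k)]
    nlinarith
  have h2 : 1 / 2 ≤ |k * N + r| := by
    have h := abs_sub_abs_le_abs_sub (k * N) (-r)
    rw [abs_neg, sub_neg_eq_add, abs_mul, abs_of_pos (by linarith : 0 < k)] at h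
    nlinarith
  rw [abs_mul]
  nlinarith

/-- Location and separation of the eigenvalues of the constant-coefficient
Bloch operators for small Bloch wave numbers `γ`. -/
theorem eigenvalue_separation_small_gamma :
    ∃ γ₀ > (0:ℝ), ∃ c > (0:ℝ), ∃ δ > (0:ℝ),
    ∀ γ ∈ Set.Icc (0:ℝ) γ₀,
    ∀ p k : ℝ, |p - 1| ≤ δ → |k - 1| ≤ δ →
      (|omegaE p k γ true 0| < 1 ∧ |omegaE p k γ false 0| < 1 ∧
        |omegaE p k γ true 1| < 1 ∧ |omegaE p k γ false (-1)| < 1) ∧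
      (|omegaE p k γ false 1| ≥ 4 ∧ |omegaE p k γ true (-1)| ≥ 4 ∧
        ∀ n : ℤ, n ≠ -1 → n ≠ 0 → n ≠ 1 →
          |omegaE p k γ true n| ≥ 4 ∧ |omegaE p k γ false n| ≥ 4) ∧
      (∀ n m : ℤ, n ≠ 0 → n ≠ 1 → m ≠ 0 → m ≠ 1 → m ≠ n → m ≠ 1 - n →
        |omegaE p k γ true n - omegaE p k γ true m| ≥ c) ∧
      (∀ n m : ℤ, n ≠ -1 → n ≠ 0 → m ≠ -1 → m ≠ 0 → m ≠ n → m ≠ -1 - n →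
        |omegaE p k γ false n - omegaE p k γ false m| ≥ c) ∧
      (∀ n m : ℤ, n ≠ 0 → n ≠ 1 → m ≠ -1 → m ≠ 0 →
        |omegaE p k γ true n - omegaE p k γ false m| ≥ c) := by
  refine ⟨1 / 20, by norm_num, 1, one_pos, 1 / 20, by norm_num, fun γ hγ p k hp hk => ?_⟩
  have hpos {n : ℤ} (h0 : n ≠ 0) (h1 : n ≠ 1) := four_le_omegaE_true hγ hp hk h0 h1
  have hneg {n : ℤ} (h1 : n ≠ -1) (h0 : n ≠ 0) := omegaE_false_le_neg_four hγ hp hk h1 h0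
  have habs {n : ℤ} (h0 : n ≠ 0) (h1 : n ≠ 1) : |omegaE p k γ true n| ≥ 4 :=
    (hpos h0 h1).trans (le_abs_self _)
  have habs' {n : ℤ} (h1 : n ≠ -1) (h0 : n ≠ 0) : |omegaE p k γ false n| ≥ 4 :=
    (le_neg_of_le_neg (hneg h1 h0)).trans (neg_le_abs _)
  obtain ⟨hγ0, hγ1⟩ := hγ
  rw [abs_le] at hp hk
  have ht0 : 0 ≤ k * γ := mul_nonneg (by linarith) hγ0
  have ht1 : k * γ ≤ 21 / 400 := by nlinarith
  refine ⟨⟨?_, ?_, ?_, ?_⟩, ⟨habs' (by decide) (by decide), habs (by decide) (by decide),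
    fun n h1 h0 h2 => ⟨habs h0 h2, habs' h1 h0⟩⟩, ?_, ?_, ?_⟩
  · rw [omegaE_true, abs_lt]
    push_cast
    constructor <;> nlinarith
  · rw [omegaE_false, abs_lt]
    push_cast
    constructor <;> nlinarith
  · rw [omegaE_true, abs_lt]
    push_cast
    constructor <;> nlinarith
  · rw [omegaE_false, abs_lt]
    push_cast
    constructor <;> nlinarith
  · intro n m _ _ _ _ hmn hm
    have h := one_le_abs_four_mul_mul (k := k) (r := k - p + 2 * (k * γ)) (d := n - m)
      (N := n + m - 1) (by linarith) (abs_le.2 ⟨by linarith, by linarith⟩) (by omega) (by omega)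
    rw [omegaE_true, omegaE_true]
    convert h using 2
    push_cast
    ring
  · intro n m _ _ _ _ hmn hm
    have h := one_le_abs_four_mul_mul (k := k) (r := p - k + 2 * (k * γ)) (d := m - n)
      (N := n + m + 1) (by linarith) (abs_le.2 ⟨by linarith, by linarith⟩) (by omega) (by omega)
    rw [omegaE_false, omegaE_false]
    convert h using 2
    push_cast
    ring
  · intro n m hn0 hn1 hm1 hm0
    exact le_trans (by linarith [hpos hn0 hn1, hneg hm1 hm0]) (le_abs_self _)
end

section
/- There exist constants γ₁ ∈ (0, 1/2), c > 0, and δ > 0 such that for all γ ∈ [γ₁, 1/2] and all p, k ∈ ℝ with |p−1| ≤ δ and |k−1| ≤ δ, the following hold, writing ω^{±,n} := ω^{±,n}_{p,k,γ}: (i) |ω^{+,0} + 1| < 1/2 and |ω^{−,−1} − 1| < 1/2; (ii) |ω^{−,0}| ≥ 5/2, |ω^{+,−1}| ≥ 5/2, and |ω^{+,n}| ≥ 5/2 and |ω^{−,n}| ≥ 5/2 for every n ∈ ℤ \ {−1,0}; (iii) |ω^{+,n} − ω^{+,m}| ≥ c for all n, m ∈ ℤ \ {0} with m ≠ n and m ≠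 −n; (iv) |ω^{−,n} − ω^{−,m}| ≥ c for all n, m ∈ ℤ \ {−1} with m ≠ n and m ≠ −2−n; (v) |ω^{+,n} − ω^{−,m}| ≥ c for all n ∈ ℤ \ {0} and m ∈ ℤ \ {−1}. -/
theorem omegaE_true_eq (p k γ : ℝ) (n : ℤ) :
    omegaE p k γ true n = (2 * k * n + (2 * k * γ - p)) ^ 2 - 1 := by
  simp only [omegaE, if_true]
  ring

theorem omegaE_false_eq (p k γ : ℝ) (n : ℤ) :
    omegaE p k γ false n =
      1 - (2 * k * ((n + 1 : ℤ) : ℝ) + (2 * k * (γ - 1) + p)) ^ 2 := by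
  simp only [omegaE, Bool.false_eq_true, if_false]
  push_cast
  ring

theorem le_abs_mul_intCast_add {k e : ℝ} {s : ℤ} (hs : s ≠ 0) (hk : 0 ≤ k) :
    2 * k - |e| ≤ |2 * k * s + e| := by
  have h1 : (1 : ℝ) ≤ |(s : ℝ)| := by exact_mod_cast Int.one_le_abs hs
  have h2 : |2 * k * (s : ℝ)| = 2 * k * |(s : ℝ)| := by
    rw [abs_mul, abs_of_nonneg (by positivity)]
  have h3 := abs_sub_abs_le_abs_add (2 * k * (s : ℝ)) e
  nlinarith

theorem seven_halves_le_sq {k e : ℝ} {s : ℤ} (hs : s ≠ 0) (hk : 99 / 100 ≤ k)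
    (he : |e| ≤ 1 / 10) : 7 / 2 ≤ (2 * k * s + e) ^ 2 := by
  have h := le_abs_mul_intCast_add (e := e) hs (by linarith : (0 : ℝ) ≤ k)
  rw [← sq_abs]
  nlinarith

theorem one_le_abs_sq_sub_sq {k e : ℝ} {s t : ℤ} (hsub : s - t ≠ 0) (hadd : s + t ≠ 0)
    (hk : 99 / 100 ≤ k) (he : |e| ≤ 1 / 10) :
    1 ≤ |(2 * k * s + e) ^ 2 - (2 * k * t + e) ^ 2| := by
  have hk0 : 0 ≤ k := by linarith
  have h1 := le_abs_mul_intCast_add (e := 0) hsub hk0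
  have h2 := le_abs_mul_intCast_add (e := 2 * e) hadd hk0
  rw [abs_zero] at h1
  rw [abs_mul, abs_of_pos (by norm_num : (0 : ℝ) < 2)] at h2
  have h : (2 * k * s + e) ^ 2 - (2 * k * t + e) ^ 2 =
      (2 * k * ((s - t : ℤ) : ℝ) + 0) * (2 * k * ((s + t : ℤ) : ℝ) + 2 * e) := by
    push_cast
    ring
  rw [h, abs_mul]
  exact one_le_mul_of_one_le_of_one_le (by linarith) (by linarith)

/-- Location and separation of the eigenvalues of the constant-coefficient
Bloch operators for Bloch wave numbers `γ` close to `1/2`. -/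
theorem eigenvalue_separation_gamma_near_half :
    ∃ γ₁ : ℝ, 0 < γ₁ ∧ γ₁ < 1/2 ∧ ∃ c > (0:ℝ), ∃ δ > (0:ℝ),
    ∀ γ ∈ Set.Icc γ₁ (1/2 : ℝ),
    ∀ p k : ℝ, |p - 1| ≤ δ → |k - 1| ≤ δ →
      (|omegaE p k γ true 0 + 1| < 1/2 ∧ |omegaE p k γ false (-1) - 1| < 1/2) ∧
      (|omegaE p k γ false 0| ≥ 5/2 ∧ |omegaE p k γ true (-1)| ≥ 5/2 ∧
        ∀ n : ℤ, n ≠ -1 → n ≠ 0 →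
          |omegaE p k γ true n| ≥ 5/2 ∧ |omegaE p k γ false n| ≥ 5/2) ∧
      (∀ n m : ℤ, n ≠ 0 → m ≠ 0 → m ≠ n → m ≠ -n →
        |omegaE p k γ true n - omegaE p k γ true m| ≥ c) ∧
      (∀ n m : ℤ, n ≠ -1 → m ≠ -1 → m ≠ n → m ≠ -2 - n →
        |omegaE p k γ false n - omegaE p k γ false m| ≥ c) ∧
      (∀ n m : ℤ, n ≠ 0 → m ≠ -1 →
        |omegaE p k γ true n - omegaE p k γ false m| ≥ c) := by
  refine ⟨49 / 100, by norm_num, by norm_num, 1, one_pos, 1 / 100, by norm_num, ?_⟩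
  rintro γ ⟨hγ₁, hγ₂⟩ p k hp hk
  rw [abs_le] at hp hk
  have hk' : 99 / 100 ≤ k := by linarith
  have he : |2 * k * γ - p| ≤ 1 / 10 := abs_le.2 ⟨by nlinarith, by nlinarith⟩
  have hf : |2 * k * (γ - 1) + p| ≤ 1 / 10 := abs_le.2 ⟨by nlinarith, by nlinarith⟩
  have htrue : ∀ n : ℤ, n ≠ 0 → 5 / 2 ≤ omegaE p k γ true n := fun n hn => by
    rw [omegaE_true_eq]
    linarith [seven_halves_le_sq hn hk' he]
  have hfalse : ∀ n : ℤ, n ≠ -1 → omegaE p k γ false n ≤ -(5 / 2) := fun n hn => by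
    rw [omegaE_false_eq]
    linarith [seven_halves_le_sq (by omega : n + 1 ≠ 0) hk' hf]
  have htrue_abs : ∀ n : ℤ, n ≠ 0 → |omegaE p k γ true n| ≥ 5 / 2 := fun n hn =>
    le_abs.2 (Or.inl (htrue n hn))
  have hfalse_abs : ∀ n : ℤ, n ≠ -1 → |omegaE p k γ false n| ≥ 5 / 2 := fun n hn =>
    le_abs.2 (Or.inr (by linarith [hfalse n hn]))
  refine ⟨⟨?_, ?_⟩, ⟨hfalse_abs 0 (by norm_num), htrue_abs (-1) (by norm_num),
    fun n hn hn' => ⟨htrue_abs n hn', hfalse_abs n hn⟩⟩, ?_, ?_, ?_⟩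
  · rw [omegaE_true_eq, Int.cast_zero, mul_zero, zero_add, sub_add_cancel, abs_sq, ← sq_abs]
    nlinarith [abs_nonneg (2 * k * γ - p)]
  · rw [omegaE_false_eq, neg_add_cancel, Int.cast_zero, mul_zero, zero_add, sub_sub_cancel_left,
      abs_neg, abs_sq, ← sq_abs]
    nlinarith [abs_nonneg (2 * k * (γ - 1) + p)]
  · intro n m _ _ hne hne'
    rw [omegaE_true_eq, omegaE_true_eq, sub_sub_sub_cancel_right]
    exact one_le_abs_sq_sub_sq (by omega) (by omega) hk' he
  · intro n m _ _ hne hne'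
    rw [omegaE_false_eq, omegaE_false_eq, sub_sub_sub_cancel_left]
    exact one_le_abs_sq_sub_sq (by omega) (by omega) hk' hf
  · intro n m hn hm
    exact le_abs.2 (Or.inl (by linarith [htrue n hn, hfalse m hm]))
end
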